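/- Let M, N be finite simple undirected graphs, each having at least one edge. Then 0 ≤ d(M,N), d(M,N) = d(N,M), and d(M,N) = 0 if and only if M and N are homomorphically equivalent (M → N and N → M). -/

import Mathlib

open Finset
open scoped Classical

/-- The measure of a vertex map `f : V(G) → V(H)` as a solution to `(G,w)` of Max H-Col:
the total `w`-weight of the edges of `G` carried by `f` to edges of `H`. -/
noncomputable def mcMeasure {V W : Type} [Fintype V] (G : SimpleGraph V) (H : SimpleGraph W)
    (w : Sym2 V → ℚ) (f : V → W) : ℚ :=
  ∑ e ∈ Finset.univ.filter (fun e : Sym2 V => e ∈ G.edgeSet ∧ Sym2.map f e ∈ H.edgeSet), w e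

/-- `mc H (G,w)`: the maximum measure over all vertex maps `f : V(G) → V(H)`. -/
noncomputable def mc {V W : Type} [Fintype V] [Fintype W]
    (G : SimpleGraph V) (H : SimpleGraph W) (w : Sym2 V → ℚ) : ℝ :=
  ⨆ f : V → W, (mcMeasure G H w f : ℝ)

/-- A weight function on `G`: positive rational weights on the edges of `G`. -/
def IsWeight {V : Type} (G : SimpleGraph V) (w : Sym2 V → ℚ) : Prop :=
  ∀ e ∈ G.edgeSet, 0 < w e

/-- `s(M,N)`: infimum of `mc_M(G,w)/mc_N(G,w)` over all graphs `G` with at least one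
edge and all weight functions `w` on `G`. -/
noncomputable def sVal {V W : Type} [Fintype V] [Fintype W]
    (M : SimpleGraph V) (N : SimpleGraph W) : ℝ :=
  sInf { r : ℝ | ∃ (n : ℕ) (G : SimpleGraph (Fin n)) (w : Sym2 (Fin n) → ℚ),
    G.edgeSet.Nonempty ∧ IsWeight G w ∧ r = mc G M w / mc G N w }

/-- `d(M,N) = 1 - s(M,N)·s(N,M)`. -/
noncomputable def dVal {V W : Type} [Fintype V] [Fintype W]
    (M : SimpleGraph V) (N : SimpleGraph W) : ℝ :=
  1 - sVal M N * sVal N M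

section McBounds

variable {V W : Type} [Fintype V]

lemma mcMeasure_nonneg (G : SimpleGraph V) (H : SimpleGraph W) {w : Sym2 V → ℚ}
    (hw : IsWeight G w) (f : V → W) : 0 ≤ mcMeasure G H w f :=
  Finset.sum_nonneg fun e he => (hw e (Finset.mem_filter.1 he).2.1).le

lemma mcMeasure_pos {G : SimpleGraph V} {H : SimpleGraph W} {w : Sym2 V → ℚ}
    (hw : IsWeight G w) {f : V → W} {e : Sym2 V} (he : e ∈ G.edgeSet)
    (hf : Sym2.map f e ∈ H.edgeSet) : 0 < mcMeasure G H w f :=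
  Finset.sum_pos (fun e he => hw e (Finset.mem_filter.1 he).2.1)
    ⟨e, Finset.mem_filter.2 ⟨Finset.mem_univ _, he, hf⟩⟩

lemma mcMeasure_le_comp {U : Type} {G : SimpleGraph V} {H : SimpleGraph W} {K : SimpleGraph U}
    {w : Sym2 V → ℚ} (hw : IsWeight G w) (φ : H →g K) (f : V → W) :
    mcMeasure G H w f ≤ mcMeasure G K w (φ ∘ f) := by
  refine Finset.sum_le_sum_of_subset_of_nonneg ?_
    fun e he _ => (hw e (Finset.mem_filter.1 he).2.1).le
  intro e he
  obtain ⟨-, he, hf⟩ := Finset.mem_filter.1 he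
  refine Finset.mem_filter.2 ⟨Finset.mem_univ _, he, ?_⟩
  rw [← Sym2.map_map]
  exact φ.map_mem_edgeSet hf

/-- A map of maximal possible measure preserves all edges. -/
lemma map_mem_edgeSet_of_sum_le {G : SimpleGraph V} {H : SimpleGraph W} {w : Sym2 V → ℚ}
    (hw : IsWeight G w) {f : V → W}
    (h : ∑ e ∈ Finset.univ.filter (fun e : Sym2 V => e ∈ G.edgeSet), w e ≤ mcMeasure G H w f)
    {e : Sym2 V} (he : e ∈ G.edgeSet) : Sym2.map f e ∈ H.edgeSet := by
  by_contra hf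
  refine h.not_gt (Finset.sum_lt_sum_of_subset (i := e) ?_ ?_ ?_ (hw e he) ?_)
  · intro e he
    simp only [Finset.mem_filter] at he ⊢
    exact ⟨he.1, he.2.1⟩
  · simpa using he
  · simp [hf]
  · exact fun e he _ => (hw e (Finset.mem_filter.1 he).2).le

lemma mcMeasure_le_sum {G : SimpleGraph V} (H : SimpleGraph W) {w : Sym2 V → ℚ}
    (hw : IsWeight G w) (f : V → W) :
    mcMeasure G H w f ≤ ∑ e ∈ Finset.univ.filter (fun e : Sym2 V => e ∈ G.edgeSet), w e := by
  refine Finset.sum_le_sum_of_subset_of_nonneg ?_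
    fun e he _ => (hw e (Finset.mem_filter.1 he).2).le
  intro e he
  simp only [Finset.mem_filter] at he ⊢
  exact ⟨he.1, he.2.1⟩

lemma mcMeasure_hom {G : SimpleGraph V} {H : SimpleGraph W} (w : Sym2 V → ℚ) (φ : G →g H) :
    mcMeasure G H w φ = ∑ e ∈ Finset.univ.filter (fun e : Sym2 V => e ∈ G.edgeSet), w e := by
  unfold mcMeasure
  congr 1
  ext e
  simp only [Finset.mem_filter]
  exact ⟨fun h => ⟨h.1, h.2.1⟩, fun h => ⟨h.1, h.2, φ.map_mem_edgeSet h.2⟩⟩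

variable [Fintype W]

lemma mcMeasure_le_mc (G : SimpleGraph V) (H : SimpleGraph W) (w : Sym2 V → ℚ) (f : V → W) :
    (mcMeasure G H w f : ℝ) ≤ mc G H w :=
  le_ciSup (f := fun f : V → W => (mcMeasure G H w f : ℝ)) (Set.finite_range _).bddAbove f

lemma mc_nonneg (G : SimpleGraph V) (H : SimpleGraph W) {w : Sym2 V → ℚ}
    (hw : IsWeight G w) : 0 ≤ mc G H w :=
  Real.iSup_nonneg fun f => by exact_mod_cast mcMeasure_nonneg G H hw f

lemma mc_pos {G : SimpleGraph V} {H : SimpleGraph W} {w : Sym2 V → ℚ}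
    (hw : IsWeight G w) (hG : G.edgeSet.Nonempty) (hH : H.edgeSet.Nonempty) : 0 < mc G H w := by
  obtain ⟨⟨u, v⟩, huv⟩ := hG
  obtain ⟨⟨x, y⟩, hxy⟩ := hH
  have hne : v ≠ u := (G.ne_of_adj huv).symm
  let f : V → W := fun a => if a = u then x else y
  have hf : Sym2.map f s(u, v) ∈ H.edgeSet := by simpa [f, hne] using hxy
  refine lt_of_lt_of_le ?_ (mcMeasure_le_mc G H w f)
  exact_mod_cast mcMeasure_pos hw huv hf

lemma mc_mono {U : Type} [Fintype U] {G : SimpleGraph V} {H : SimpleGraph W} {K : SimpleGraph U}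
    {w : Sym2 V → ℚ} (hw : IsWeight G w) (φ : H →g K) : mc G H w ≤ mc G K w :=
  Real.iSup_le (fun f => le_trans (by exact_mod_cast mcMeasure_le_comp hw φ f)
    (mcMeasure_le_mc G K w (φ ∘ f))) (mc_nonneg G K hw)

lemma mc_eq_sum_of_hom {G : SimpleGraph V} {H : SimpleGraph W} {w : Sym2 V → ℚ}
    (hw : IsWeight G w) (φ : G →g H) :
    mc G H w = (∑ e ∈ Finset.univ.filter (fun e : Sym2 V => e ∈ G.edgeSet), w e : ℚ) := by
  have : Nonempty (V → W) := ⟨φ⟩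
  refine le_antisymm (ciSup_le fun f => by exact_mod_cast mcMeasure_le_sum H hw f) ?_
  rw [← mcMeasure_hom w φ]
  exact mcMeasure_le_mc G H w φ

end McBounds

section SVal

lemma exists_hom_of_adj {A : Type} {M : SimpleGraph A} {x y : A} (h : M.Adj x y) :
    Nonempty ((⊤ : SimpleGraph (Fin 2)) →g M) := by
  refine ⟨⟨![x, y], ?_⟩⟩
  intro a b hab
  fin_cases a <;> fin_cases b <;> simp_all [M.adj_comm]

lemma edgeSet_top_fin_two_nonempty : (⊤ : SimpleGraph (Fin 2)).edgeSet.Nonempty :=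
  ⟨s(0, 1), by simp⟩

variable {A B : Type} [Fintype A] [Fintype B] {M : SimpleGraph A} {N : SimpleGraph B}

lemma sVal_nonneg (M : SimpleGraph A) (N : SimpleGraph B) : 0 ≤ sVal M N := by
  refine Real.sInf_nonneg ?_
  rintro r ⟨n, G, w, -, hw, rfl⟩
  exact div_nonneg (mc_nonneg G M hw) (mc_nonneg G N hw)

lemma sVal_le_div {n : ℕ} {G : SimpleGraph (Fin n)} {w : Sym2 (Fin n) → ℚ}
    (hG : G.edgeSet.Nonempty) (hw : IsWeight G w) : sVal M N ≤ mc G M w / mc G N w := by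
  refine csInf_le ⟨0, ?_⟩ ⟨n, G, w, hG, hw, rfl⟩
  rintro r ⟨n, G, w, -, hw, rfl⟩
  exact div_nonneg (mc_nonneg G M hw) (mc_nonneg G N hw)

lemma sVal_le_one (hM : M.edgeSet.Nonempty) (hN : N.edgeSet.Nonempty) : sVal M N ≤ 1 := by
  obtain ⟨⟨x, y⟩, hxy⟩ := id hM
  obtain ⟨⟨x', y'⟩, hxy'⟩ := hN
  obtain ⟨φ⟩ := exists_hom_of_adj (M := M) hxy
  obtain ⟨ψ⟩ := exists_hom_of_adj (M := N) hxy'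
  have hw : IsWeight (⊤ : SimpleGraph (Fin 2)) (fun _ => 1) := fun _ _ => one_pos
  refine (sVal_le_div edgeSet_top_fin_two_nonempty hw).trans_eq ?_
  rw [mc_eq_sum_of_hom hw ψ, ← mc_eq_sum_of_hom hw φ]
  exact div_self (mc_pos hw edgeSet_top_fin_two_nonempty hM).ne'

lemma one_le_sVal_of_hom (hN : N.edgeSet.Nonempty) (φ : N →g M) : 1 ≤ sVal M N := by
  refine le_csInf ⟨_, 2, ⊤, fun _ => 1, edgeSet_top_fin_two_nonempty, fun _ _ => one_pos, rfl⟩ ?_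
  rintro r ⟨n, G, w, hG, hw, rfl⟩
  exact (one_le_div (mc_pos hw hG hN)).2 (mc_mono hw φ)

lemma nonempty_hom_of_one_le_sVal (hM : M.edgeSet.Nonempty) (hN : N.edgeSet.Nonempty)
    (h : 1 ≤ sVal M N) : Nonempty (N →g M) := by
  obtain ⟨n, ⟨σ⟩⟩ := Finite.exists_equiv_fin B
  let G : SimpleGraph (Fin n) := N.map σ.toEmbedding
  let ι : N ≃g G := SimpleGraph.Iso.map σ N
  have hG : G.edgeSet.Nonempty := by
    obtain ⟨e, he⟩ := hN
    exact ⟨_, ι.toHom.map_mem_edgeSet he⟩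
  have hw : IsWeight G (fun _ => 1) := fun _ _ => one_pos
  have hle := (one_le_div (mc_pos hw hG hN)).1 (h.trans (sVal_le_div hG hw))
  rw [mc_eq_sum_of_hom hw ι.symm.toHom] at hle
  have : Nonempty (Fin n → A) := by
    obtain ⟨⟨x, y⟩, -⟩ := hM
    exact ⟨fun _ => x⟩
  obtain ⟨f, hf⟩ := exists_eq_ciSup_of_finite
    (f := fun f : Fin n → A => (mcMeasure G M (fun _ => 1) f : ℝ))
  rw [mc, ← hf] at hle
  have hmap := fun e he => map_mem_edgeSet_of_sum_le hw (by exact_mod_cast hle) (e := e) he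
  exact ⟨(⟨f, fun {a b} hab => hmap s(a, b) hab⟩ : G →g M).comp ι.toHom⟩

lemma sVal_eq_one_iff (hM : M.edgeSet.Nonempty) (hN : N.edgeSet.Nonempty) :
    sVal M N = 1 ↔ Nonempty (N →g M) :=
  ⟨fun h => nonempty_hom_of_one_le_sVal hM hN h.ge,
    fun ⟨φ⟩ => (sVal_le_one hM hN).antisymm (one_le_sVal_of_hom hN φ)⟩

end SVal

/-- `0 ≤ d(M,N)`, `d(M,N) = d(N,M)`, and `d(M,N) = 0` iff `M` and `N`
are homomorphically equivalent. -/
theorem stmt5 {A B : Type} [Fintype A] [Fintype B]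
    (M : SimpleGraph A) (N : SimpleGraph B)
    (hM : M.edgeSet.Nonempty) (hN : N.edgeSet.Nonempty) :
    0 ≤ dVal M N ∧ dVal M N = dVal N M ∧
      (dVal M N = 0 ↔ (Nonempty (M →g N) ∧ Nonempty (N →g M))) := by
  have h₁ := sVal_nonneg M N
  have h₂ := sVal_nonneg N M
  have h₃ := sVal_le_one hM hN
  have h₄ := sVal_le_one hN hM
  refine ⟨sub_nonneg.2 (mul_le_one₀ h₃ h₂ h₄), by rw [dVal, dVal, mul_comm], ?_⟩
  rw [← sVal_eq_one_iff hM hN, ← sVal_eq_one_iff hN hM, dVal, sub_eq_zero]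
  constructor
  · intro h
    constructor <;> nlinarith
  · rintro ⟨h, h'⟩
    rw [h, h', one_mul]
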